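/- Let α, β > 0, let θ, x₁, …, x_n ∈ ℝ^d, let y₁, …, y_n ∈ ℝ, and write x_{ij}(λ) = λ x_i + (1−λ) x_j and y_{ij}(λ) = λ y_i + (1−λ) y_j. Define the logistic mixup loss L_mix = (1/n²) ∑_{i=1}^n ∑_{j=1}^n E_{λ∼Beta(α,β)}[ h(⟨θ, x_{ij}(λ)⟩) − y_{ij}(λ)·⟨θ, x_{ij}(λ)⟩ ], with h(t) = log(1 + exp(t)). Then L_mix = (1/n²) ∑_{i=1}^n ∑_{j=1}^n E_{λ∼P̃}[ h(⟨θ, x_{ij}(λ)⟩) − y_i·⟨θ, x_{ij}(λ)⟩ ], where P̃ is the mixture distribution P̃ = (α/(α+β))·Beta(α+1, β) + (β/(α+β))·Beta(β+1, α), and all expectations are integrals against the corresponding Beta densities on [0, 1]. -/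

import Mathlib

open RealInnerProductSpace

/-- Softplus function `h(t) = log (1 + exp t)`. -/
noncomputable def softplus (t : ℝ) : ℝ := Real.log (1 + Real.exp t)

/-- The Beta function `B(a, b) = ∫₀¹ x^(a−1) (1−x)^(b−1) dx`. -/
noncomputable def betaFn (a b : ℝ) : ℝ :=
  ∫ x in (0:ℝ)..1, x ^ (a - 1) * (1 - x) ^ (b - 1)

/-- Expectation of `f` under the `Beta(a, b)` distribution on `[0, 1]`. -/
noncomputable def betaExp (a b : ℝ) (f : ℝ → ℝ) : ℝ :=
  (∫ l in (0:ℝ)..1, f l * (l ^ (a - 1) * (1 - l) ^ (b - 1))) / betaFn a b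

/-- Expectation of `f` under the mixture distribution
`P̃ = (α/(α+β))·Beta(α+1, β) + (β/(α+β))·Beta(β+1, α)`. -/
noncomputable def ptildeExp (α β : ℝ) (f : ℝ → ℝ) : ℝ :=
  (α / (α + β)) * betaExp (α + 1) β f + (β / (α + β)) * betaExp (β + 1) α f

theorem ofReal_betaWeight (a b : ℝ) {l : ℝ} (hl : l ∈ Set.Icc (0 : ℝ) 1) :
    (l : ℂ) ^ ((a : ℂ) - 1) * (1 - (l : ℂ)) ^ ((b : ℂ) - 1) =
      ((l ^ (a - 1) * (1 - l) ^ (b - 1) : ℝ) : ℂ) := by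
  rw [Complex.ofReal_mul, Complex.ofReal_cpow hl.1, Complex.ofReal_cpow (sub_nonneg.2 hl.2)]
  push_cast
  rfl

theorem intervalIntegrable_betaWeight {a b : ℝ} (ha : 0 < a) (hb : 0 < b) :
    IntervalIntegrable (fun l : ℝ => l ^ (a - 1) * (1 - l) ^ (b - 1))
      MeasureTheory.volume 0 1 := by
  have h := Complex.betaIntegral_convergent (u := (a : ℂ)) (v := (b : ℂ)) (by simpa) (by simpa)
  rw [intervalIntegrable_iff] at h ⊢
  refine MeasureTheory.IntegrableOn.congr_fun h.re (fun l hl => ?_) measurableSet_uIoc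
  rw [Set.uIoc_of_le zero_le_one] at hl
  simp only [ofReal_betaWeight a b (Set.Ioc_subset_Icc_self hl)]
  exact Complex.ofReal_re _

theorem ofReal_betaFn (a b : ℝ) : (betaFn a b : ℂ) = Complex.betaIntegral a b := by
  rw [betaFn, Complex.betaIntegral, ← intervalIntegral.integral_ofReal]
  refine intervalIntegral.integral_congr fun l hl => ?_
  rw [Set.uIcc_of_le zero_le_one] at hl
  exact (ofReal_betaWeight a b hl).symm

theorem betaFn_eq_beta {a b : ℝ} (ha : 0 < a) (hb : 0 < b) :
    betaFn a b = ProbabilityTheory.beta a b := by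
  rw [ProbabilityTheory.beta_eq_betaIntegralReal a b ha hb, ← ofReal_betaFn, Complex.ofReal_re]

theorem betaFn_add_one_left {a b : ℝ} (ha : 0 < a) (hb : 0 < b) :
    betaFn (a + 1) b = a / (a + b) * betaFn a b := by
  have hab : 0 < a + b := add_pos ha hb
  have hΓ := (Real.Gamma_pos_of_pos hab).ne'
  rw [betaFn_eq_beta (by positivity) hb, betaFn_eq_beta ha hb, ProbabilityTheory.beta,
    ProbabilityTheory.beta, add_right_comm, Real.Gamma_add_one ha.ne', Real.Gamma_add_one hab.ne']
  field_simp

theorem betaExp_id_mul {a b : ℝ} (ha : 0 < a) (hb : 0 < b) (f : ℝ → ℝ) :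
    betaExp a b (fun l => l * f l) = a / (a + b) * betaExp (a + 1) b f := by
  have hB : betaFn a b ≠ 0 := by
    rw [betaFn_eq_beta ha hb]
    exact (ProbabilityTheory.beta_pos ha hb).ne'
  have hint : (∫ l in (0 : ℝ)..1, l * f l * (l ^ (a - 1) * (1 - l) ^ (b - 1))) =
      ∫ l in (0 : ℝ)..1, f l * (l ^ (a + 1 - 1) * (1 - l) ^ (b - 1)) := by
    refine intervalIntegral.integral_congr_Ioo_of_le zero_le_one fun l hl => ?_
    have hpow : l ^ (a + 1 - 1) = l ^ (a - 1) * l := by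
      rw [← Real.rpow_add_one hl.1.ne']
      ring_nf
    simp only [hpow]
    ring
  have hab : a + b ≠ 0 := (add_pos ha hb).ne'
  rw [betaExp, betaExp, hint, betaFn_add_one_left ha hb]
  field_simp

theorem integral_betaWeight_reflect (a b : ℝ) (f : ℝ → ℝ) :
    (∫ l in (0 : ℝ)..1, f (1 - l) * (l ^ (b - 1) * (1 - l) ^ (a - 1))) =
      ∫ l in (0 : ℝ)..1, f l * (l ^ (a - 1) * (1 - l) ^ (b - 1)) := by
  have h := intervalIntegral.integral_comp_sub_left (a := 0) (b := 1)
    (fun l : ℝ => f l * (l ^ (a - 1) * (1 - l) ^ (b - 1))) 1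
  simp only [sub_sub_cancel, sub_self, sub_zero] at h
  rw [← h]
  simp only [mul_comm]

theorem betaExp_reflect (a b : ℝ) (f : ℝ → ℝ) :
    betaExp b a (fun l => f (1 - l)) = betaExp a b f := by
  have hB : betaFn b a = betaFn a b := by
    simpa [betaFn] using integral_betaWeight_reflect a b (fun _ => 1)
  rw [betaExp, betaExp, integral_betaWeight_reflect, hB]

theorem betaExp_add {a b : ℝ} (ha : 0 < a) (hb : 0 < b) {f g : ℝ → ℝ}
    (hf : Continuous f) (hg : Continuous g) :
    betaExp a b (fun l => f l + g l) = betaExp a b f + betaExp a b g := by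
  have hw := intervalIntegrable_betaWeight ha hb
  simp only [betaExp, add_mul]
  rw [intervalIntegral.integral_add (hw.continuousOn_mul hf.continuousOn)
    (hw.continuousOn_mul hg.continuousOn), add_div]

theorem continuous_softplus : Continuous softplus := by
  unfold softplus
  exact (continuous_const.add Real.continuous_exp).log fun t => (add_pos one_pos (Real.exp_pos t)).ne'

/-- Splitting a `λ`-interpolation of two losses under `Beta(α, β)` into two shifted
Beta expectations. -/
theorem betaExp_interpolate {a b : ℝ} (ha : 0 < a) (hb : 0 < b) {f g : ℝ → ℝ}
    (hf : Continuous f) (hg : Continuous g) :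
    betaExp a b (fun l => l * f l + (1 - l) * g (1 - l)) =
      a / (a + b) * betaExp (a + 1) b f + b / (a + b) * betaExp (b + 1) a g := by
  rw [betaExp_add ha hb (by fun_prop) (by fun_prop), betaExp_id_mul ha hb,
    betaExp_reflect b a (fun l => l * g l), betaExp_id_mul hb ha, add_comm b a]

theorem stmt13 {d n : ℕ} (α β : ℝ) (hα : 0 < α) (hβ : 0 < β)
    (θ : EuclideanSpace ℝ (Fin d)) (x : Fin n → EuclideanSpace ℝ (Fin d)) (y : Fin n → ℝ) :
    (1 / (n : ℝ) ^ 2) * ∑ i, ∑ j, betaExp α β (fun l =>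
        softplus ⟪θ, l • x i + (1 - l) • x j⟫ -
          (l * y i + (1 - l) * y j) * ⟪θ, l • x i + (1 - l) • x j⟫) =
      (1 / (n : ℝ) ^ 2) * ∑ i, ∑ j, ptildeExp α β (fun l =>
        softplus ⟪θ, l • x i + (1 - l) • x j⟫ -
          y i * ⟪θ, l • x i + (1 - l) • x j⟫) := by
  have hcont (i j : Fin n) : Continuous fun l : ℝ =>
      softplus ⟪θ, l • x i + (1 - l) • x j⟫ - y i * ⟪θ, l • x i + (1 - l) • x j⟫ := by
    have := continuous_softplus
    fun_prop
  have hsplit (i j : Fin n) :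
      betaExp α β (fun l => softplus ⟪θ, l • x i + (1 - l) • x j⟫ -
          (l * y i + (1 - l) * y j) * ⟪θ, l • x i + (1 - l) • x j⟫) =
        α / (α + β) * betaExp (α + 1) β (fun l =>
          softplus ⟪θ, l • x i + (1 - l) • x j⟫ - y i * ⟪θ, l • x i + (1 - l) • x j⟫) +
        β / (α + β) * betaExp (β + 1) α (fun l =>
          softplus ⟪θ, l • x j + (1 - l) • x i⟫ - y j * ⟪θ, l • x j + (1 - l) • x i⟫) := by
    rw [← betaExp_interpolate hα hβ (hcont i j) (hcont j i)]
    congr 1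
    funext l
    rw [sub_sub_cancel, add_comm ((1 - l) • x j)]
    ring
  simp only [hsplit, ptildeExp, Finset.sum_add_distrib]
  congr 2
  exact Finset.sum_comm
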